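/- arXiv:2403.11187 — 6 statements merged into one kernel-verified Lean document; each statement's English description precedes it below -/
import Mathlib

section
/- Let (Ω, μ) be a probability space, Θ a fixed N_t×L complex matrix, R_B an N_t×N_t complex matrix, R_A an N_r×N_r complex matrix, and σ_w² ≥ 0 a real number. Let g : Ω → ℂ^{N_t N_r} (indexed by pairs (t,r)) and w : Ω → ℂ^{L N_r} (indexed by pairs (l,r)) be random vectors whose entrywise products are integrable and which satisfy: E[g_i conj(g_j)] = (R_B ⊗ R_A)_{i,j} for all i,j; E[w_i conj(w_j)] = σ_w² (I_L ⊗ R_A)_{i,j} for all i,j; and E[g_i conj(w_j)] = 0 for all i,j. Define y = (Θ^T ⊗ I_{N_r}) g + w. Then E[y_i conj(y_j)] = ((Θ^T R_B Θ^* + σ_w² I_L) ⊗ R_A)_{i,j} for all i,j. -/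
open Matrix Kronecker MeasureTheory

/-- Covariance of a linear image of a random vector plus uncorrelated noise:
the signal contributes `K * R * Kᴴ` and the noise contributes its own covariance. -/
theorem integral_mulVec_add_mul_star {m n Ω : Type*} [Fintype n] [MeasurableSpace Ω]
    {μ : Measure Ω} (K : Matrix m n ℂ) (R : Matrix n n ℂ) (N : Matrix m m ℂ)
    (g : Ω → n → ℂ) (w : Ω → m → ℂ)
    (hgg_int : ∀ i j, Integrable (fun ω => g ω i * (starRingEnd ℂ) (g ω j)) μ)
    (hww_int : ∀ i j, Integrable (fun ω => w ω i * (starRingEnd ℂ) (w ω j)) μ)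
    (hgw_int : ∀ i j, Integrable (fun ω => g ω i * (starRingEnd ℂ) (w ω j)) μ)
    (hwg_int : ∀ i j, Integrable (fun ω => w ω i * (starRingEnd ℂ) (g ω j)) μ)
    (hgg : ∀ i j, ∫ ω, g ω i * (starRingEnd ℂ) (g ω j) ∂μ = R i j)
    (hww : ∀ i j, ∫ ω, w ω i * (starRingEnd ℂ) (w ω j) ∂μ = N i j)
    (hgw : ∀ i j, ∫ ω, g ω i * (starRingEnd ℂ) (w ω j) ∂μ = 0) (i j : m) :
    ∫ ω, (K *ᵥ g ω + w ω) i * (starRingEnd ℂ) ((K *ᵥ g ω + w ω) j) ∂μ =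
      (K * R * Kᴴ + N) i j := by
  have hwg : ∀ i j, ∫ ω, w ω i * (starRingEnd ℂ) (g ω j) ∂μ = 0 := fun i j => by
    have h := integral_conj (μ := μ) (f := fun ω => g ω j * (starRingEnd ℂ) (w ω i))
    simpa [hgw, mul_comm] using h
  have expand : ∀ ω, (K *ᵥ g ω + w ω) i * (starRingEnd ℂ) ((K *ᵥ g ω + w ω) j) =
      (∑ b, ∑ a, K i a * (starRingEnd ℂ) (K j b) * (g ω a * (starRingEnd ℂ) (g ω b))) +
      (∑ a, K i a * (g ω a * (starRingEnd ℂ) (w ω j))) +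
      (∑ b, (starRingEnd ℂ) (K j b) * (w ω i * (starRingEnd ℂ) (g ω b))) +
      w ω i * (starRingEnd ℂ) (w ω j) := fun ω => by
    have hsum : (∑ a, K i a * g ω a) * (∑ b, (starRingEnd ℂ) (K j b) * (starRingEnd ℂ) (g ω b)) =
        ∑ b, ∑ a, K i a * (starRingEnd ℂ) (K j b) * (g ω a * (starRingEnd ℂ) (g ω b)) := by
      simp_rw [Finset.mul_sum, Finset.sum_mul]
      exact Finset.sum_congr rfl fun b _ => Finset.sum_congr rfl fun a _ => by ring
    have hcross : (∑ a, K i a * g ω a) * (starRingEnd ℂ) (w ω j) =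
        ∑ a, K i a * (g ω a * (starRingEnd ℂ) (w ω j)) := by
      simp_rw [Finset.sum_mul, mul_assoc]
    have hcross_conj : w ω i * (∑ b, (starRingEnd ℂ) (K j b) * (starRingEnd ℂ) (g ω b)) =
        ∑ b, (starRingEnd ℂ) (K j b) * (w ω i * (starRingEnd ℂ) (g ω b)) := by
      simp_rw [Finset.mul_sum, mul_left_comm]
    simp only [Pi.add_apply, mulVec, dotProduct, map_add, map_sum, map_mul]
    rw [← hsum, ← hcross, ← hcross_conj]
    ring
  have hgg_sum := integrable_finsetSum Finset.univ fun b _ =>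
    integrable_finsetSum Finset.univ fun a _ =>
      (hgg_int a b).const_mul (K i a * (starRingEnd ℂ) (K j b))
  have hgw_sum := integrable_finsetSum Finset.univ fun a _ => (hgw_int a j).const_mul (K i a)
  have hwg_sum := integrable_finsetSum Finset.univ fun b _ =>
    (hwg_int i b).const_mul ((starRingEnd ℂ) (K j b))
  simp_rw [expand]
  rw [integral_add ((hgg_sum.fun_add hgw_sum).fun_add hwg_sum) (hww_int i j),
    integral_add (hgg_sum.fun_add hgw_sum) hwg_sum, integral_add hgg_sum hgw_sum,
    integral_finsetSum _ fun b _ => integrable_finsetSum Finset.univ fun a _ =>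
      (hgg_int a b).const_mul (K i a * (starRingEnd ℂ) (K j b)),
    integral_finsetSum _ fun a _ => (hgw_int a j).const_mul (K i a),
    integral_finsetSum _ fun b _ => (hwg_int i b).const_mul ((starRingEnd ℂ) (K j b))]
  simp_rw [integral_finsetSum Finset.univ fun a _ =>
    (hgg_int a _).const_mul (K i a * (starRingEnd ℂ) (K j _)), integral_const_mul, hgg, hww,
    hgw, hwg]
  simp only [mul_zero, Finset.sum_const_zero, add_zero, Matrix.add_apply, Matrix.mul_apply,
    conjTranspose_apply, Finset.sum_mul, starRingEnd_apply]
  congr 1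
  exact Finset.sum_congr rfl fun b _ => Finset.sum_congr rfl fun a _ => by ring

/-- Covariance of the received signal y = (Θᵀ ⊗ I) g + w:
E[y yᴴ] = (Θᵀ R_B Θ* + σ_w² I_L) ⊗ R_A. -/
theorem received_signal_covariance (Nt Nr L : ℕ)
    (Ω : Type) [MeasurableSpace Ω] (μ : Measure Ω) [IsProbabilityMeasure μ]
    (Θ : Matrix (Fin Nt) (Fin L) ℂ)
    (RB : Matrix (Fin Nt) (Fin Nt) ℂ) (RA : Matrix (Fin Nr) (Fin Nr) ℂ)
    (σw2 : ℝ) (hσ : 0 ≤ σw2)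
    (g : Ω → (Fin Nt × Fin Nr) → ℂ) (w : Ω → (Fin L × Fin Nr) → ℂ)
    (hgg_int : ∀ i j, Integrable (fun ω => g ω i * (starRingEnd ℂ) (g ω j)) μ)
    (hww_int : ∀ i j, Integrable (fun ω => w ω i * (starRingEnd ℂ) (w ω j)) μ)
    (hgw_int : ∀ i j, Integrable (fun ω => g ω i * (starRingEnd ℂ) (w ω j)) μ)
    (hwg_int : ∀ i j, Integrable (fun ω => w ω i * (starRingEnd ℂ) (g ω j)) μ)
    (hgg : ∀ i j, ∫ ω, g ω i * (starRingEnd ℂ) (g ω j) ∂μ = (RB ⊗ₖ RA) i j)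
    (hww : ∀ i j, ∫ ω, w ω i * (starRingEnd ℂ) (w ω j) ∂μ =
      (σw2 : ℂ) * ((1 : Matrix (Fin L) (Fin L) ℂ) ⊗ₖ RA) i j)
    (hgw : ∀ i j, ∫ ω, g ω i * (starRingEnd ℂ) (w ω j) ∂μ = 0)
    (y : Ω → (Fin L × Fin Nr) → ℂ)
    (hy : ∀ ω, y ω =
      (Θ.transpose ⊗ₖ (1 : Matrix (Fin Nr) (Fin Nr) ℂ)).mulVec (g ω) + w ω) :
    ∀ i j, ∫ ω, y ω i * (starRingEnd ℂ) (y ω j) ∂μ =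
      (((Θ.transpose * RB * Θ.map (starRingEnd ℂ) +
        (σw2 : ℂ) • (1 : Matrix (Fin L) (Fin L) ℂ)) ⊗ₖ RA)) i j := by
  intro i j
  have key := integral_mulVec_add_mul_star
    (Θ.transpose ⊗ₖ (1 : Matrix (Fin Nr) (Fin Nr) ℂ)) (RB ⊗ₖ RA)
    ((σw2 : ℂ) • ((1 : Matrix (Fin L) (Fin L) ℂ) ⊗ₖ RA)) g w
    hgg_int hww_int hgw_int hwg_int hgg hww hgw i j
  have hconj : Θ.transposeᴴ = Θ.map (starRingEnd ℂ) := by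
    ext; simp
  simp_rw [hy]
  rw [key, conjTranspose_kronecker, hconj, conjTranspose_one, ← mul_kronecker_mul,
    ← mul_kronecker_mul, Matrix.one_mul, Matrix.mul_one, add_kronecker, smul_kronecker]
end

section
/- Let C and D be L×L complex matrices with D Hermitian positive semidefinite, let M and N be P×P complex matrices with N Hermitian positive semidefinite, let β > 0 be real, and let U be a P×P unitary matrix. Then (D ⊗ (U N U^H)) + β I_{LP} is invertible, (D ⊗ N) + β I_{LP} is invertible, and Tr( (C ⊗ (U M U^H)) · ((D ⊗ (U N U^H)) + β I_{LP})^{-1} ) = Tr( (C ⊗ M) · ((D ⊗ N) + β I_{LP})^{-1} ). In particular, the task-based quantization objective f_A is invariant under replacing the analog combining matrix Ā by U Ā for any unitary U. -/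
open Matrix Kronecker ComplexOrder

theorem Matrix.PosSemidef.isUnit_add_smul_one {n : Type*} [Fintype n] [DecidableEq n]
    {A : Matrix n n ℂ} (hA : A.PosSemidef) {β : ℝ} (hβ : 0 < β) :
    IsUnit (A + (β : ℂ) • (1 : Matrix n n ℂ)) := by
  have hβ' : (0 : ℂ) < (β : ℂ) := by exact_mod_cast hβ
  exact (PosDef.posSemidef_add hA (PosDef.one.smul hβ')).isUnit

theorem Matrix.one_kronecker_conj {l p R : Type*} [Fintype l] [DecidableEq l] [Fintype p]
    [CommRing R] [StarRing R] (A : Matrix l l R) (U X : Matrix p p R) :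
    A ⊗ₖ (U * X * Uᴴ) = ((1 : Matrix l l R) ⊗ₖ U) * (A ⊗ₖ X) * ((1 : Matrix l l R) ⊗ₖ U)ᴴ := by
  simp [conjTranspose_kronecker, ← mul_kronecker_mul]

theorem Matrix.trace_conj_mul_inv_conj {n R : Type*} [Fintype n] [DecidableEq n]
    [CommRing R] [StarRing R] {W : Matrix n n R} (hW : W * Wᴴ = 1) (A B : Matrix n n R) :
    trace (W * A * Wᴴ * (W * B * Wᴴ)⁻¹) = trace (A * B⁻¹) := by
  have hW' : Wᴴ * W = 1 := mul_eq_one_comm.mp hW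
  have hinv : (W * B * Wᴴ)⁻¹ = W * B⁻¹ * Wᴴ := by
    rw [Matrix.mul_inv_rev, Matrix.mul_inv_rev, inv_eq_left_inv hW, inv_eq_left_inv hW',
      Matrix.mul_assoc]
  calc trace (W * A * Wᴴ * (W * B * Wᴴ)⁻¹) = trace (W * A * (Wᴴ * W) * B⁻¹ * Wᴴ) := by
        rw [hinv]; simp only [Matrix.mul_assoc]
    _ = trace (A * B⁻¹) := by
        rw [trace_mul_comm]
        simp only [← Matrix.mul_assoc, hW', Matrix.one_mul, Matrix.mul_one]

/-- The task-based quantization objective is invariant under unitary rotation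
of the analog combining matrix: for D, N PSD, β > 0 and U unitary,
Tr((C ⊗ U M Uᴴ)((D ⊗ U N Uᴴ) + βI)⁻¹) = Tr((C ⊗ M)((D ⊗ N) + βI)⁻¹). -/
theorem trace_kronecker_invariant_under_unitary_rotation (L P : ℕ)
    (C D : Matrix (Fin L) (Fin L) ℂ) (hD : D.PosSemidef)
    (M N : Matrix (Fin P) (Fin P) ℂ) (hN : N.PosSemidef)
    (β : ℝ) (hβ : 0 < β)
    (U : Matrix (Fin P) (Fin P) ℂ) (hU : U * Uᴴ = 1) :
    IsUnit ((D ⊗ₖ (U * N * Uᴴ)) +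
        (β : ℂ) • (1 : Matrix (Fin L × Fin P) (Fin L × Fin P) ℂ)) ∧
    IsUnit ((D ⊗ₖ N) +
        (β : ℂ) • (1 : Matrix (Fin L × Fin P) (Fin L × Fin P) ℂ)) ∧
    Matrix.trace ((C ⊗ₖ (U * M * Uᴴ)) *
        ((D ⊗ₖ (U * N * Uᴴ)) +
          (β : ℂ) • (1 : Matrix (Fin L × Fin P) (Fin L × Fin P) ℂ))⁻¹) =
      Matrix.trace ((C ⊗ₖ M) *
        ((D ⊗ₖ N) +
          (β : ℂ) • (1 : Matrix (Fin L × Fin P) (Fin L × Fin P) ℂ))⁻¹) := by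
  have hW : ((1 : Matrix (Fin L) (Fin L) ℂ) ⊗ₖ U) * ((1 : Matrix (Fin L) (Fin L) ℂ) ⊗ₖ U)ᴴ = 1 := by
    simp [conjTranspose_kronecker, ← mul_kronecker_mul, hU]
  refine ⟨(hD.kronecker (hN.mul_mul_conjTranspose_same U)).isUnit_add_smul_one hβ,
    (hD.kronecker hN).isUnit_add_smul_one hβ, ?_⟩
  rw [one_kronecker_conj C, one_kronecker_conj D, ← trace_conj_mul_inv_conj hW (C ⊗ₖ M)]
  simp only [Matrix.mul_add, Matrix.add_mul, Matrix.mul_smul, Matrix.smul_mul, Matrix.mul_one, hW]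
end

section
/- Let X be an n×n Hermitian complex matrix, n ≥ 1. Then: (a) there exists an n×n unitary matrix U such that every diagonal entry of U X U^H equals Tr(X)/n; and (b) for every n×n unitary matrix U, max_{1≤i≤n} Re((U X U^H)_{i,i}) ≥ Re(Tr(X))/n. Consequently, the minimum over unitary U of the largest diagonal entry of U X U^H equals Tr(X)/n. -/
open Matrix

/-- The normalized discrete Fourier matrix is unitary, and all its entries have the same modulus. -/
theorem exists_unitary_entries_mul_star_eq_inv (n : ℕ) (hn : 0 < n) :
    ∃ F : Matrix (Fin n) (Fin n) ℂ, F * Fᴴ = 1 ∧ ∀ i j, F i j * star (F i j) = (n : ℂ)⁻¹ := by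
  have : NeZero n := ⟨hn.ne'⟩
  have hsqrt : ((Real.sqrt n : ℝ) : ℂ)⁻¹ * ((Real.sqrt n : ℝ) : ℂ)⁻¹ = (n : ℂ)⁻¹ := by
    rw [← mul_inv, ← Complex.ofReal_mul, Real.mul_self_sqrt n.cast_nonneg, Complex.ofReal_natCast]
  have hstar (a : ZMod n) : star (ZMod.stdAddChar a) = ZMod.stdAddChar (-a) :=
    (AddChar.map_neg_eq_conj _ a).symm
  have hentry (a b : ZMod n) :
      ((Real.sqrt n : ℝ) : ℂ)⁻¹ * ZMod.stdAddChar a *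
        star (((Real.sqrt n : ℝ) : ℂ)⁻¹ * ZMod.stdAddChar b) =
      (n : ℂ)⁻¹ * ZMod.stdAddChar (a - b) := by
    rw [star_mul', hstar, star_inv₀, Complex.star_def, Complex.conj_ofReal, mul_mul_mul_comm,
      hsqrt, ← AddChar.map_add_eq_mul, sub_eq_add_neg]
  have hsum (t : ZMod n) : ∑ s : ZMod n, ZMod.stdAddChar (t * s) = if t = 0 then (n : ℂ) else 0 := by
    simpa [mul_comm, ZMod.card] using
      AddChar.sum_mulShift t (ZMod.isPrimitive_stdAddChar n)
  let e : Fin n ≃ ZMod n := (ZMod.finEquiv n).toEquiv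
  refine ⟨Matrix.of fun i j => ((Real.sqrt n : ℝ) : ℂ)⁻¹ * ZMod.stdAddChar (e i * e j), ?_, ?_⟩
  · ext i k
    simp only [Matrix.mul_apply, Matrix.conjTranspose_apply, Matrix.of_apply, hentry, ← sub_mul,
      ← Finset.mul_sum]
    rw [e.sum_comp fun s => ZMod.stdAddChar ((e i - e k) * s), hsum, Matrix.one_apply]
    simp [sub_eq_zero, hn.ne']
  · intro i j
    simp only [Matrix.of_apply, hentry, sub_self, AddChar.map_zero_eq_one, mul_one]

/-- A Hermitian matrix is unitarily equivalent to a matrix with constant diagonal. -/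
theorem Matrix.IsHermitian.exists_unitary_diag_eq_trace_div {n : ℕ} (hn : 0 < n)
    {X : Matrix (Fin n) (Fin n) ℂ} (hX : X.IsHermitian) :
    ∃ U : Matrix (Fin n) (Fin n) ℂ, U * Uᴴ = 1 ∧
      ∀ i, (U * X * Uᴴ) i i = Matrix.trace X / n := by
  obtain ⟨F, hF, hentry⟩ := exists_unitary_entries_mul_star_eq_inv n hn
  have hdiag := hX.conjStarAlgAut_star_eigenvectorUnitary
  rw [Unitary.conjStarAlgAut_star_apply] at hdiag
  have hV := Unitary.coe_star_mul_self hX.eigenvectorUnitary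
  set V : Matrix (Fin n) (Fin n) ℂ := hX.eigenvectorUnitary.val
  rw [Matrix.star_eq_conjTranspose] at hdiag hV
  refine ⟨F * Vᴴ, ?_, fun i => ?_⟩
  · rw [Matrix.conjTranspose_mul, Matrix.conjTranspose_conjTranspose, Matrix.mul_assoc,
      ← Matrix.mul_assoc Vᴴ, hV, Matrix.one_mul, hF]
  · have hconj : F * Vᴴ * X * (F * Vᴴ)ᴴ = F * (Vᴴ * X * V) * Fᴴ := by
      simp only [Matrix.conjTranspose_mul, Matrix.conjTranspose_conjTranspose, Matrix.mul_assoc]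
    rw [hconj, hdiag, Matrix.mul_apply, hX.trace_eq_sum_eigenvalues, div_eq_mul_inv,
      Finset.sum_mul]
    refine Finset.sum_congr rfl fun j _ => ?_
    rw [Matrix.mul_diagonal, Matrix.conjTranspose_apply, mul_right_comm, hentry, mul_comm]
    rfl

/-- The largest real part of a diagonal entry is at least the average one. -/
theorem Matrix.trace_re_div_le_sup'_diag {n : ℕ} (hn : 0 < n) (A : Matrix (Fin n) (Fin n) ℂ)
    (hne : (Finset.univ : Finset (Fin n)).Nonempty) :
    (Matrix.trace A).re / n ≤ Finset.univ.sup' hne (fun i => (A i i).re) := by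
  rw [div_le_iff₀ (Nat.cast_pos.mpr hn), Matrix.trace, Complex.re_sum]
  have hsum := Finset.sum_le_card_nsmul Finset.univ (fun i => (A i i).re)
    (Finset.univ.sup' hne fun i => (A i i).re)
    fun i hi => Finset.le_sup' (fun i => (A i i).re) hi
  simpa [mul_comm] using hsum

open Matrix

/-- For a Hermitian X: (a) some unitary rotation makes all diagonal entries of
U X Uᴴ equal to Tr(X)/n; (b) for any unitary U, the largest (real part of a)
diagonal entry of U X Uᴴ is at least Re(Tr X)/n; consequently the minimum over
unitary U of the largest diagonal entry of U X Uᴴ equals Re(Tr X)/n. -/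
theorem exists_unitary_equal_diagonal_and_min_max_diag (n : ℕ) (hn : 0 < n)
    (X : Matrix (Fin n) (Fin n) ℂ) (hX : X.IsHermitian) :
    (∃ U : Matrix (Fin n) (Fin n) ℂ, U * Uᴴ = 1 ∧
      ∀ i, (U * X * Uᴴ) i i = Matrix.trace X / n) ∧
    (∀ U : Matrix (Fin n) (Fin n) ℂ, U * Uᴴ = 1 →
      (Matrix.trace X).re / n ≤
        Finset.univ.sup' (Finset.univ_nonempty_iff.mpr (Fin.pos_iff_nonempty.mp hn))
          (fun i => ((U * X * Uᴴ) i i).re)) ∧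
    IsLeast {m : ℝ | ∃ U : Matrix (Fin n) (Fin n) ℂ, U * Uᴴ = 1 ∧
        m = Finset.univ.sup' (Finset.univ_nonempty_iff.mpr (Fin.pos_iff_nonempty.mp hn))
          (fun i => ((U * X * Uᴴ) i i).re)}
      ((Matrix.trace X).re / n) := by
  have hlower (U : Matrix (Fin n) (Fin n) ℂ) (hU : U * Uᴴ = 1) :
      (Matrix.trace X).re / n ≤
        Finset.univ.sup' (Finset.univ_nonempty_iff.mpr (Fin.pos_iff_nonempty.mp hn))
          (fun i => ((U * X * Uᴴ) i i).re) := by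
    have htrace : (U * X * Uᴴ).trace = X.trace := by
      rw [Matrix.trace_mul_comm, ← Matrix.mul_assoc, mul_eq_one_comm.mp hU, Matrix.one_mul]
    rw [← htrace]
    exact Matrix.trace_re_div_le_sup'_diag hn _ _
  obtain ⟨U, hU, hdiag⟩ := hX.exists_unitary_diag_eq_trace_div hn
  refine ⟨⟨U, hU, hdiag⟩, hlower, ⟨U, hU, ?_⟩, ?_⟩
  · simp only [hdiag, Complex.div_natCast_re, Finset.sup'_const]
  · rintro m ⟨W, hW, rfl⟩
    exact hlower W hW
end

section
/- Let Λ' be an N_t×L complex matrix and Λ a P×N_r complex matrix, each rectangular-diagonal in the sense that its (i,j) entry is zero unless the indices i and j are equal as natural numbers. Let σ² ≥ 0 and c > 0 be real. Then the (L P)×(L P) matrix ((Λ'^H Λ' + σ² I_L) ⊗ (Λ Λ^H)) + c I_{LP} is invertible, and the (N_t N_r)×(N_t N_r) matrix M = (Λ' ⊗ Λ^H) · (((Λ'^H Λ' + σ² I_L) ⊗ (Λ Λ^H)) + c I_{LP})^{-1} · (Λ'^H ⊗ Λ) is diagonal, i.e., M_{(n,r),(n',r')} = 0 whenever (n,r)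 ≠ (n',r'). -/
open Matrix Kronecker

/-- A rectangular-diagonal matrix: its entries vanish off the positions with equal indices. -/
def IsRectDiag {m n : ℕ} (A : Matrix (Fin m) (Fin n) ℂ) : Prop :=
  ∀ (i : Fin m) (j : Fin n), (i : ℕ) ≠ (j : ℕ) → A i j = 0

theorem IsRectDiag.conjTranspose {m n : ℕ} {A : Matrix (Fin m) (Fin n) ℂ}
    (hA : IsRectDiag A) : IsRectDiag Aᴴ := fun i j hij => by
  rw [conjTranspose_apply, hA j i hij.symm, star_zero]

theorem IsRectDiag.isDiag_mul {m n : ℕ} {A : Matrix (Fin m) (Fin n) ℂ}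
    {B : Matrix (Fin n) (Fin m) ℂ} (hA : IsRectDiag A) (hB : IsRectDiag B) :
    (A * B).IsDiag := fun i j hij => by
  beta_reduce
  rw [Matrix.mul_apply]
  refine Finset.sum_eq_zero fun k _ => ?_
  by_cases hik : (i : ℕ) = k
  · rw [hB k j fun hkj => hij (Fin.ext (hik.trans hkj)), mul_zero]
  · rw [hA i k hik, zero_mul]

theorem isDiag_inv {n : Type*} [Fintype n] [DecidableEq n] {D : Matrix n n ℂ}
    (hD : D.IsDiag) : D⁻¹.IsDiag := by
  rw [← hD.diagonal_diag, inv_diagonal]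
  exact isDiag_diagonal _

theorem kronecker_mul_isDiag_mul_kronecker_isDiag {a b m n : ℕ}
    {A : Matrix (Fin a) (Fin m) ℂ} {B : Matrix (Fin b) (Fin n) ℂ}
    {C : Matrix (Fin m) (Fin a) ℂ} {E : Matrix (Fin n) (Fin b) ℂ}
    {D : Matrix (Fin m × Fin n) (Fin m × Fin n) ℂ}
    (hA : IsRectDiag A) (hB : IsRectDiag B) (hC : IsRectDiag C) (hE : IsRectDiag E)
    (hD : D.IsDiag) : ((A ⊗ₖ B) * D * (C ⊗ₖ E)).IsDiag := fun p q hpq => by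
  beta_reduce
  rw [← hD.diagonal_diag, Matrix.mul_apply]
  refine Finset.sum_eq_zero fun k _ => ?_
  rw [mul_diagonal, kroneckerMap_apply, kroneckerMap_apply]
  by_cases h₁ : (p.1 : ℕ) = k.1
  · by_cases h₂ : (p.2 : ℕ) = k.2
    · by_cases h₃ : (k.1 : ℕ) = q.1
      · have h₄ : (k.2 : ℕ) ≠ q.2 := fun h₄ =>
          hpq (Prod.ext (Fin.ext (h₁.trans h₃)) (Fin.ext (h₂.trans h₄)))
        simp [hE _ _ h₄]
      · simp [hC _ _ h₃]
    · simp [hB _ _ h₂]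
  · simp [hA _ _ h₁]

open scoped ComplexOrder in
theorem isUnit_gram_kronecker_gram_add {a l p r : Type*} [Fintype a] [Fintype l] [Fintype p]
    [Fintype r] [DecidableEq l] [DecidableEq p] (A : Matrix a l ℂ) (B : Matrix p r ℂ)
    {s c : ℝ} (hs : 0 ≤ s) (hc : 0 < c) :
    IsUnit ((Aᴴ * A + (s : ℂ) • (1 : Matrix l l ℂ)) ⊗ₖ (B * Bᴴ) +
      (c : ℂ) • (1 : Matrix (l × p) (l × p) ℂ)) := by
  have hs' : (0 : ℂ) ≤ (s : ℂ) := by exact_mod_cast hs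
  have hc' : (0 : ℂ) < (c : ℂ) := by exact_mod_cast hc
  have hpsd := ((posSemidef_conjTranspose_mul_self A).add
    (PosSemidef.one.smul hs')).kronecker (posSemidef_self_mul_conjTranspose B)
  exact (PosDef.posSemidef_add hpsd (PosDef.one.smul hc')).isUnit

/-- For rectangular-diagonal Λ' (N_t×L) and Λ (P×N_r), σ² ≥ 0 and c > 0, the
matrix ((Λ'ᴴΛ' + σ²I) ⊗ (ΛΛᴴ)) + cI is invertible and
M = (Λ' ⊗ Λᴴ)·(((Λ'ᴴΛ' + σ²I) ⊗ (ΛΛᴴ)) + cI)⁻¹·(Λ'ᴴ ⊗ Λ) is diagonal. -/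
theorem kronecker_sandwich_of_rect_diagonal_is_diagonal (Nt L P Nr : ℕ)
    (Λ' : Matrix (Fin Nt) (Fin L) ℂ)
    (hΛ' : ∀ (i : Fin Nt) (j : Fin L), (i : ℕ) ≠ (j : ℕ) → Λ' i j = 0)
    (Λ : Matrix (Fin P) (Fin Nr) ℂ)
    (hΛ : ∀ (i : Fin P) (j : Fin Nr), (i : ℕ) ≠ (j : ℕ) → Λ i j = 0)
    (σ2 c : ℝ) (hσ : 0 ≤ σ2) (hc : 0 < c) :
    IsUnit ((Λ'ᴴ * Λ' + (σ2 : ℂ) • (1 : Matrix (Fin L) (Fin L) ℂ)) ⊗ₖ (Λ * Λᴴ) +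
        (c : ℂ) • (1 : Matrix (Fin L × Fin P) (Fin L × Fin P) ℂ)) ∧
    ∀ p q : (Fin Nt × Fin Nr), p ≠ q →
      ((Λ' ⊗ₖ Λᴴ) *
        ((Λ'ᴴ * Λ' + (σ2 : ℂ) • (1 : Matrix (Fin L) (Fin L) ℂ)) ⊗ₖ (Λ * Λᴴ) +
          (c : ℂ) • (1 : Matrix (Fin L × Fin P) (Fin L × Fin P) ℂ))⁻¹ *
        (Λ'ᴴ ⊗ₖ Λ)) p q = 0 := by
  have hΛ'' : IsRectDiag Λ' := hΛ'
  have hΛd : IsRectDiag Λ := hΛ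
  refine ⟨?_, fun p q hpq => ?_⟩
  · exact isUnit_gram_kronecker_gram_add Λ' Λ hσ hc
  · have hdiag := (((hΛ''.conjTranspose.isDiag_mul hΛ'').add (isDiag_one.smul (σ2 : ℂ))).kronecker
      (hΛd.isDiag_mul hΛd.conjTranspose)).add (isDiag_one.smul (c : ℂ))
    exact kronecker_mul_isDiag_mul_kronecker_isDiag hΛ'' hΛd.conjTranspose
      hΛ''.conjTranspose hΛd (isDiag_inv hdiag) hpq
end

section
/- Let N, P ≥ 1 be integers and let d_n ≥ 0, b_n ≥ 0 (for n = 1,…,N), a_i ≥ 0 (for i = 1,…,P), c ≥ 0 and β > 0 be real numbers. Then the function f : ℝ^P → ℝ defined by f(x) = Σ_{n=1}^{N} Σ_{i=1}^{P} d_n · a_i · b_n · x_i / ((b_n + c)·x_i + β) is concave on the set {x ∈ ℝ^P : x_i ≥ 0 for all i}. In particular, the quantizer optimization problems maximizing such objectives subject to Σ_i x_i = 1, x_i ≥ 0 are convex optimization problems. -/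
/-- The saturating ratio `u ↦ u / (k * u + β)` is concave on `[0, ∞)`. -/
theorem concaveOn_div_mul_add {k β : ℝ} (hk : 0 ≤ k) (hβ : 0 < β) :
    ConcaveOn ℝ (Set.Ici 0) (fun u : ℝ => u / (k * u + β)) := by
  refine ⟨convex_Ici 0, ?_⟩
  intro x hx y hy s t hs ht hst
  simp only [Set.mem_Ici] at hx hy
  simp only [smul_eq_mul]
  obtain rfl : s = 1 - t := by linarith
  have hA : 0 < k * x + β := by positivity
  have hB : 0 < k * y + β := by positivity
  have hC : 0 < k * ((1 - t) * x + t * y) + β := by positivity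
  have key : ((1 - t) * x + t * y) / (k * ((1 - t) * x + t * y) + β)
      - ((1 - t) * (x / (k * x + β)) + t * (y / (k * y + β)))
      = β * k * (1 - t) * t * (x - y) ^ 2
        / ((k * x + β) * (k * y + β) * (k * ((1 - t) * x + t * y) + β)) := by
    have hA' := hA.ne'
    have hB' := hB.ne'
    have hC' := hC.ne'
    rw [← mul_div_assoc, ← mul_div_assoc, div_add_div _ _ hA' hB',
      div_sub_div _ _ hC' (mul_ne_zero hA' hB'),
      div_eq_div_iff (mul_ne_zero hC' (mul_ne_zero hA' hB'))
        (mul_ne_zero (mul_ne_zero hA' hB') hC')]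
    ring
  rw [← sub_nonneg, key]
  positivity

/-- The quantizer-design objective
f(x) = Σ_n Σ_i d_n·a_i·b_n·x_i / ((b_n + c)·x_i + β) is concave on the
nonnegative orthant of ℝ^P. -/
theorem concaveOn_quantizer_objective (N P : ℕ) (hN : 1 ≤ N) (hP : 1 ≤ P)
    (d b : Fin N → ℝ) (a : Fin P → ℝ) (c β : ℝ)
    (hd : ∀ n, 0 ≤ d n) (hb : ∀ n, 0 ≤ b n) (ha : ∀ i, 0 ≤ a i)
    (hc : 0 ≤ c) (hβ : 0 < β) :
    ConcaveOn ℝ {x : Fin P → ℝ | ∀ i, 0 ≤ x i}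
      (fun x => ∑ n : Fin N, ∑ i : Fin P,
        d n * a i * b n * x i / ((b n + c) * x i + β)) := by
  have hconv : Convex ℝ {x : Fin P → ℝ | ∀ i, 0 ≤ x i} := by
    intro x hx y hy s t hs ht _ i
    have := hx i
    have := hy i
    simp only [Pi.add_apply, Pi.smul_apply, smul_eq_mul]
    positivity
  refine ⟨hconv, ?_⟩
  intro x hx y hy s t hs ht hst
  simp only [smul_eq_mul, Finset.mul_sum, ← Finset.sum_add_distrib]
  refine Finset.sum_le_sum fun n _ => Finset.sum_le_sum fun i _ => ?_
  have h := (concaveOn_div_mul_add (add_nonneg (hb n) hc) hβ).2 (hx i) (hy i) hs ht hst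
  have hw : 0 ≤ d n * a i * b n := mul_nonneg (mul_nonneg (hd n) (ha i)) (hb n)
  have h' := mul_le_mul_of_nonneg_left h hw
  simp only [smul_eq_mul] at h'
  simp only [Pi.add_apply, Pi.smul_apply, smul_eq_mul, mul_div_assoc (d n * a i * b n)]
  linarith
end

section
/- Let R be an n×n Hermitian positive semidefinite complex matrix with eigenvalues λ_1 ≥ λ_2 ≥ … ≥ λ_n (listed with multiplicity in descending order), and let c_1 ≥ c_2 ≥ … ≥ c_n ≥ 0 be real numbers. Then for every n×n unitary matrix V, Σ_{i=1}^{n} c_i · Re((V^H R V)_{i,i}) ≤ Σ_{i=1}^{n} c_i · λ_i, and equality holds when V is a unitary eigenmatrix of R whose columns are eigenvectors ordered so that V^H R V = diag(λ_1, …, λ_n). -/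
open Matrix ComplexOrder

/-- A doubly stochastic matrix does not increase the pairing of two monovarying vectors. -/
lemma dotProduct_mulVec_le_of_mem_doublyStochastic {ι : Type*} [Fintype ι] [DecidableEq ι]
    {M : Matrix ι ι ℝ} (hM : M ∈ doublyStochastic ℝ ι) {f g : ι → ℝ} (hfg : Monovary f g) :
    f ⬝ᵥ M *ᵥ g ≤ f ⬝ᵥ g := by
  obtain ⟨w, hw0, hw1, rfl⟩ := exists_eq_sum_perm_of_mem_doublyStochastic hM
  calc f ⬝ᵥ (∑ σ, w σ • σ.permMatrix ℝ) *ᵥ g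
      = ∑ σ, w σ * ∑ i, f i * g (σ i) := by
        simp only [Matrix.sum_mulVec, dotProduct_sum, Matrix.smul_mulVec,
          Matrix.permMatrix_mulVec, dotProduct_smul, smul_eq_mul]
        rfl
    _ ≤ ∑ σ, w σ * f ⬝ᵥ g :=
        Finset.sum_le_sum fun σ _ =>
          mul_le_mul_of_nonneg_left hfg.sum_mul_comp_perm_le_sum_mul (hw0 σ)
    _ = f ⬝ᵥ g := by rw [← Finset.sum_mul, hw1, one_mul]

lemma sum_normSq_row_eq_one {ι : Type*} [Fintype ι] [DecidableEq ι]
    {U : Matrix ι ι ℂ} (hU : U * Uᴴ = 1) (i : ι) : ∑ j, Complex.normSq (U i j) = 1 := by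
  have h := congrArg Complex.re (congrFun (congrFun hU i) i)
  simpa [Matrix.mul_apply, Complex.mul_conj] using h

lemma normSq_conjTranspose_mem_doublyStochastic {ι : Type*} [Fintype ι] [DecidableEq ι]
    {U : Matrix ι ι ℂ} (hU : U * Uᴴ = 1) :
    Uᴴ.map Complex.normSq ∈ doublyStochastic ℝ ι := by
  have hU' : Uᴴ * Uᴴᴴ = 1 := by
    rw [conjTranspose_conjTranspose]
    exact mul_eq_one_comm.mp hU
  refine mem_doublyStochastic_iff_sum.mpr ⟨fun i j => Complex.normSq_nonneg _,
    sum_normSq_row_eq_one hU', fun j => ?_⟩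
  simpa using sum_normSq_row_eq_one hU j

lemma re_conjTranspose_mul_diagonal_mul_apply_self {ι : Type*} [Fintype ι] [DecidableEq ι]
    (U : Matrix ι ι ℂ) (d : ι → ℝ) (i : ι) :
    ((Uᴴ * diagonal (fun j => (d j : ℂ)) * U) i i).re =
      (Uᴴ.map Complex.normSq *ᵥ d) i := by
  rw [Matrix.mul_apply, Complex.re_sum]
  refine Finset.sum_congr rfl fun j _ => ?_
  simp only [Matrix.mul_diagonal, conjTranspose_apply, map_apply, Complex.star_def,
    Complex.normSq_apply, Complex.mul_re, Complex.mul_im, Complex.conj_re,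
    Complex.conj_im, Complex.ofReal_re, Complex.ofReal_im]
  ring

/-- For a Hermitian PSD matrix R with eigenvalues λ₁ ≥ … ≥ λₙ and weights
c₁ ≥ … ≥ cₙ ≥ 0, every unitary V satisfies
Σᵢ cᵢ·Re((Vᴴ R V)ᵢᵢ) ≤ Σᵢ cᵢ·λᵢ, with equality when Vᴴ R V = diag(λ). -/
theorem weighted_diagonal_sum_le_weighted_eigenvalue_sum (n : ℕ)
    (R : Matrix (Fin n) (Fin n) ℂ) (hR : R.PosSemidef)
    (lam : Fin n → ℝ) (hlam : Antitone lam)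
    (hdiag : ∃ W : Matrix (Fin n) (Fin n) ℂ, W * Wᴴ = 1 ∧
      Wᴴ * R * W = Matrix.diagonal (fun i => (lam i : ℂ)))
    (c : Fin n → ℝ) (hc : Antitone c) (hc0 : ∀ i, 0 ≤ c i) :
    (∀ V : Matrix (Fin n) (Fin n) ℂ, V * Vᴴ = 1 →
      ∑ i, c i * ((Vᴴ * R * V) i i).re ≤ ∑ i, c i * lam i) ∧
    (∀ V : Matrix (Fin n) (Fin n) ℂ, V * Vᴴ = 1 →
      Vᴴ * R * V = Matrix.diagonal (fun i => (lam i : ℂ)) →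
      ∑ i, c i * ((Vᴴ * R * V) i i).re = ∑ i, c i * lam i) := by
  refine ⟨fun V hV => ?_, fun V _ h => by simp [h]⟩
  obtain ⟨W, hW, hWR⟩ := hdiag
  have hU : (Wᴴ * V) * (Wᴴ * V)ᴴ = 1 := by
    rw [conjTranspose_mul, conjTranspose_conjTranspose, Matrix.mul_assoc, ← Matrix.mul_assoc V,
      hV, Matrix.one_mul, mul_eq_one_comm.mp hW]
  have hVR : Vᴴ * R * V =
      (Wᴴ * V)ᴴ * diagonal (fun i => (lam i : ℂ)) * (Wᴴ * V) := by
    calc Vᴴ * R * V = Vᴴ * (W * Wᴴ) * R * (W * Wᴴ) * V := by simp [hW]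
      _ = (Wᴴ * V)ᴴ * (Wᴴ * R * W) * (Wᴴ * V) := by
        simp only [conjTranspose_mul, conjTranspose_conjTranspose, Matrix.mul_assoc]
      _ = _ := by rw [hWR]
  simp_rw [hVR, re_conjTranspose_mul_diagonal_mul_apply_self]
  exact dotProduct_mulVec_le_of_mem_doublyStochastic
    (normSq_conjTranspose_mem_doublyStochastic hU) (hc.monovary hlam)
end
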